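/- arXiv:1612.05280 — 2 statements merged into one kernel-verified Lean document; each statement's English description precedes it below -/
import Mathlib

section
/- Let μ be a singular probability measure on ℝ and f : [−1,1] → ℝ a 1-Lipschitz function with f(0) = 0. Then the set X_f = {g ∈ X : f ∈ Tan(g,x) for μ-almost every x} is residual in the complete metric space X of 1-Lipschitz functions on ℝ with the supremum distance (i.e. X_f contains a countable intersection of open dense sets). -/
open MeasureTheory Filter

/-- The complete metric space of `1`-Lipschitz functions `ℝ → ℝ`. -/
def XLip : Type := {g : ℝ → ℝ // LipschitzWith 1 g}

/-- The set of blowups of `g` at `x`: all uniform limits on `[-1,1]` of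
`y ↦ (g (x + r y) - g x) / r` along sequences `r_j ↘ 0`. -/
def Tan1 (g : ℝ → ℝ) (x : ℝ) : Set ((Set.Icc (-1 : ℝ) 1) → ℝ) :=
  {f | ∃ r : ℕ → ℝ, (∀ j, 0 < r j) ∧ Tendsto r atTop (nhds 0) ∧
    TendstoUniformly (fun j (y : Set.Icc (-1 : ℝ) 1) => (g (x + r j * ↑y) - g x) / r j)
      f atTop}

/-- At every point of `S`, the function `g` looks like `f` up to a relative error uniformly smaller
than `ε`, at some scale at most `ε` that is bounded below uniformly on `S`. -/
def ResemblesOn (f : Set.Icc (-1 : ℝ) 1 → ℝ) (ε : ℝ) (g : ℝ → ℝ) (S : Set ℝ) : Prop :=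
  ∃ r₀ > 0, ∃ η < ε, ∀ x ∈ S, ∃ r, r₀ ≤ r ∧ r ≤ ε ∧
    ∀ y : Set.Icc (-1 : ℝ) 1, |g (x + r * y) - g x - r * f y| ≤ η * r

lemma ResemblesOn.exists_of_close {f : Set.Icc (-1 : ℝ) 1 → ℝ} {ε : ℝ} {g : ℝ → ℝ} {S : Set ℝ}
    (hg : ResemblesOn f ε g S) :
    ∃ δ > 0, ∀ h : ℝ → ℝ, (∀ x, |h x - g x| ≤ δ) → ResemblesOn f ε h S := by
  obtain ⟨r₀, hr₀, η, hη, H⟩ := hg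
  refine ⟨r₀ * (ε - η) / 4, by have := sub_pos.2 hη; positivity, fun h hh => ?_⟩
  refine ⟨r₀, hr₀, (η + ε) / 2, by linarith, fun x hx => ?_⟩
  obtain ⟨r, h1, h2, h3⟩ := H x hx
  refine ⟨r, h1, h2, fun y => ?_⟩
  have e1 := abs_le.1 (hh x)
  have e2 := abs_le.1 (hh (x + r * y))
  have e3 := abs_le.1 (h3 y)
  have e4 : r₀ * (ε - η) ≤ r * (ε - η) := mul_le_mul_of_nonneg_right h1 (by linarith)
  rw [abs_le]
  constructor <;> linarith

lemma ResemblesOn.union {f : Set.Icc (-1 : ℝ) 1 → ℝ} {ε : ℝ} {g : ℝ → ℝ} {S T : Set ℝ}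
    (hS : ResemblesOn f ε g S) (hT : ResemblesOn f ε g T) : ResemblesOn f ε g (S ∪ T) := by
  obtain ⟨r₀, hr₀, η, hη, H⟩ := hS
  obtain ⟨r₁, hr₁, θ, hθ, H'⟩ := hT
  refine ⟨min r₀ r₁, lt_min hr₀ hr₁, max η θ, max_lt hη hθ, ?_⟩
  rintro x (hx | hx)
  · obtain ⟨r, h1, h2, h3⟩ := H x hx
    exact ⟨r, (min_le_left _ _).trans h1, h2, fun y => (h3 y).trans
      (mul_le_mul_of_nonneg_right (le_max_left _ _) (hr₀.le.trans h1))⟩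
  · obtain ⟨r, h1, h2, h3⟩ := H' x hx
    exact ⟨r, (min_le_right _ _).trans h1, h2, fun y => (h3 y).trans
      (mul_le_mul_of_nonneg_right (le_max_right _ _) (hr₁.le.trans h1))⟩

lemma mem_Tan1_of_resembles {f : Set.Icc (-1 : ℝ) 1 → ℝ} {g : ℝ → ℝ} {x : ℝ} {S : ℕ → Set ℝ}
    (hg : ∀ k : ℕ, ResemblesOn f (1 / ((k : ℝ) + 1)) g (S k)) (hx : ∀ᶠ k in atTop, x ∈ S k) :
    f ∈ Tan1 g x := by
  obtain ⟨K, hK⟩ := eventually_atTop.1 hx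
  have key : ∀ k : ℕ, ∃ r, 0 < r ∧ r ≤ 1 / (((k + K : ℕ) : ℝ) + 1) ∧
      ∀ y : Set.Icc (-1 : ℝ) 1,
        |g (x + r * y) - g x - r * f y| ≤ 1 / (((k + K : ℕ) : ℝ) + 1) * r := by
    intro k
    obtain ⟨r₀, hr₀, η, hη, H⟩ := hg (k + K)
    obtain ⟨r, h1, h2, h3⟩ := H x (hK _ (Nat.le_add_left _ _))
    exact ⟨r, hr₀.trans_le h1, h2, fun y => (h3 y).trans
      (mul_le_mul_of_nonneg_right hη.le (hr₀.le.trans h1))⟩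
  choose r hr0 hr1 hr2 using key
  have hlim : Tendsto (fun k : ℕ => 1 / (((k + K : ℕ) : ℝ) + 1)) atTop (nhds 0) :=
    (tendsto_add_atTop_iff_nat (f := fun k : ℕ => 1 / ((k : ℝ) + 1)) K).2
      tendsto_one_div_add_atTop_nhds_zero_nat
  refine ⟨r, hr0, squeeze_zero (fun k => (hr0 k).le) hr1 hlim, ?_⟩
  rw [Metric.tendstoUniformly_iff]
  intro ε hε
  filter_upwards [hlim.eventually_lt_const hε] with k hk y
  rw [dist_comm, Real.dist_eq]
  have e : (g (x + r k * y) - g x) / r k - f y = (g (x + r k * y) - g x - r k * f y) / r k := by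
    field_simp [(hr0 k).ne']
  rw [e, abs_div, abs_of_pos (hr0 k)]
  exact ((div_le_iff₀ (hr0 k)).2 (hr2 k y)).trans_lt hk

lemma exists_lipschitzWith_splice {F g : ℝ → ℝ} (hF : LipschitzWith 1 F) (hg : LipschitzWith 1 g)
    {V : Set ℝ} (hV : MeasurableSet V) {δ : ℝ} (hδ : 0 ≤ δ) (hVδ : volume V ≤ ENNReal.ofReal δ) :
    ∃ h : ℝ → ℝ, LipschitzWith 1 h ∧ (∀ x, |h x - g x| ≤ 2 * δ) ∧
      ∀ a b, Set.uIcc a b ⊆ V → h b - h a = F b - F a := by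
  classical
  have bd : ∀ {G : ℝ → ℝ}, LipschitzWith 1 G → ∀ x, ‖deriv G x‖ ≤ 1 := fun hG x => by
    simpa using norm_deriv_le_of_lipschitz (x₀ := x) hG
  have ftc : ∀ {G : ℝ → ℝ}, LipschitzWith 1 G → ∀ a b, ∫ t in a..b, deriv G t = G b - G a :=
    fun hG a b =>
      (hG.lipschitzOnWith.absolutelyContinuousOnInterval).integral_deriv_eq_sub
  have intg : ∀ {k : ℝ → ℝ}, Measurable k → (∀ x, ‖k x‖ ≤ 1) → ∀ a b,
      IntervalIntegrable k volume a b := fun hk hk1 a b =>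
    (intervalIntegrable_const (c := (1 : ℝ))).mono_fun hk.aestronglyMeasurable
      (Eventually.of_forall fun x => by simpa using hk1 x)
  set k : ℝ → ℝ := V.piecewise (deriv F) (deriv g) with hk
  have km : Measurable k := (measurable_deriv F).piecewise hV (measurable_deriv g)
  have k1 : ∀ x, ‖k x‖ ≤ 1 := fun x => by
    by_cases hx : x ∈ V
    · simpa only [hk, Set.piecewise_eq_of_mem _ _ _ hx] using bd hF x
    · simpa only [hk, Set.piecewise_eq_of_notMem _ _ _ hx] using bd hg x
  have sub : ∀ a b, (g 0 + ∫ t in (0 : ℝ)..b, k t) - (g 0 + ∫ t in (0 : ℝ)..a, k t)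
      = ∫ t in a..b, k t := fun a b => by
    rw [add_sub_add_left_eq_sub,
      intervalIntegral.integral_interval_sub_left (intg km k1 _ _) (intg km k1 _ _)]
  refine ⟨fun x => g 0 + ∫ t in (0 : ℝ)..x, k t, ?_, fun x => ?_, fun a b hab => ?_⟩
  · refine LipschitzWith.of_dist_le_mul fun x y => ?_
    rw [Real.dist_eq, sub, Real.dist_eq]
    simpa using intervalIntegral.norm_integral_le_of_norm_le_const (a := y) (b := x)
      (fun t _ => k1 t)
  · have e : (g 0 + ∫ t in (0 : ℝ)..x, k t) - g x = ∫ t in (0 : ℝ)..x, (k t - deriv g t) := by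
      rw [intervalIntegral.integral_sub (intg km k1 _ _)
        (intg (measurable_deriv g) (bd hg) _ _), ftc hg]
      ring
    have e' : (fun t => k t - deriv g t) = V.indicator fun t => deriv F t - deriv g t := by
      funext t
      by_cases ht : t ∈ V <;> simp [hk, ht]
    simp only
    rw [e, e', ← Real.norm_eq_abs, intervalIntegral.norm_integral_eq_norm_integral_uIoc,
      setIntegral_indicator hV]
    have hfin : volume (Set.uIoc 0 x ∩ V) ≤ ENNReal.ofReal δ :=
      (measure_mono Set.inter_subset_right).trans hVδ
    refine (norm_setIntegral_le_of_norm_le_const (C := 2) (hfin.trans_lt ENNReal.ofReal_lt_top)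
      fun t _ => ?_).trans ?_
    · linarith [norm_sub_le (deriv F t) (deriv g t), bd hF t, bd hg t]
    · have : volume.real (Set.uIoc 0 x ∩ V) ≤ δ := ENNReal.toReal_le_of_le_ofReal hδ hfin
      linarith
  · simp only
    rw [sub, ← ftc hF]
    exact intervalIntegral.integral_congr fun t ht => by simp [hk, hab ht]

/-- The triangular wave of period `4` that is the identity on `[-1, 1]`. -/
noncomputable def triangularWave (x : ℝ) : ℝ := ‖((x + 1 : ℝ) : AddCircle (4 : ℝ))‖ - 1

lemma triangularWave_mem_Icc (x : ℝ) : triangularWave x ∈ Set.Icc (-1 : ℝ) 1 := by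
  have h1 := AddCircle.norm_le_half_period (4 : ℝ) (x := ((x + 1 : ℝ) : AddCircle (4 : ℝ)))
    (by norm_num)
  have h2 := norm_nonneg ((x + 1 : ℝ) : AddCircle (4 : ℝ))
  rw [abs_of_pos (by norm_num : (0 : ℝ) < 4)] at h1
  exact ⟨by unfold triangularWave; linarith, by unfold triangularWave; linarith⟩

lemma abs_triangularWave_sub_le (x y : ℝ) :
    |triangularWave x - triangularWave y| ≤ |x - y| := by
  unfold triangularWave
  rw [sub_sub_sub_cancel_right]
  refine (abs_norm_sub_norm_le _ _).trans ?_
  rw [← AddCircle.coe_sub, add_sub_add_right_eq_sub]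
  exact QuotientAddGroup.norm_mk_le_norm

lemma triangularWave_add_of_mem {y : ℝ} (hy : y ∈ Set.Icc (-1 : ℝ) 1) (n : ℤ) :
    triangularWave (4 * n + y) = y := by
  have e : ((4 * n + y + 1 : ℝ) : AddCircle (4 : ℝ)) = ((y + 1 : ℝ) : AddCircle (4 : ℝ)) := by
    rw [show (4 * n + y + 1 : ℝ) = (y + 1) + n • (4 : ℝ) by simp; ring]
    simp
  have h : |y + 1| = y + 1 := abs_of_nonneg (by linarith [hy.1])
  unfold triangularWave
  rw [e, (AddCircle.norm_coe_eq_abs_iff (4 : ℝ) (by norm_num)).2, h]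
  · ring
  · rw [h, abs_of_pos (by norm_num : (0 : ℝ) < 4)]
    linarith [hy.2]

lemma exists_lipschitzWith_periodic {f : Set.Icc (-1 : ℝ) 1 → ℝ} (hf : LipschitzWith 1 f)
    (a : ℝ) {s : ℝ} (hs : 0 < s) :
    ∃ F : ℝ → ℝ, LipschitzWith 1 F ∧
      ∀ (n : ℤ) (y : Set.Icc (-1 : ℝ) 1), F (a + 4 * s * n + s * y) = s * f y := by
  refine ⟨fun x => s * f ⟨triangularWave ((x - a) / s), triangularWave_mem_Icc _⟩, ?_, ?_⟩
  · refine LipschitzWith.of_dist_le_mul fun x y => ?_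
    have h1 := hf.dist_le_mul ⟨triangularWave ((x - a) / s), triangularWave_mem_Icc _⟩
      ⟨triangularWave ((y - a) / s), triangularWave_mem_Icc _⟩
    have h2 := abs_triangularWave_sub_le ((x - a) / s) ((y - a) / s)
    rw [Subtype.dist_eq, NNReal.coe_one, one_mul, Real.dist_eq, Real.dist_eq] at h1
    rw [← sub_div, sub_sub_sub_cancel_right, abs_div, abs_of_pos hs, le_div_iff₀ hs] at h2
    rw [NNReal.coe_one, one_mul, Real.dist_eq, Real.dist_eq, ← mul_sub, abs_mul, abs_of_pos hs]
    linarith [mul_le_mul_of_nonneg_left h1 hs.le]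
  · intro n y
    have e : (a + 4 * s * n + s * y - a) / s = 4 * n + y := by field_simp; ring
    simp only [e, triangularWave_add_of_mem y.2]

lemma exists_abs_sub_lattice_le {w : ℝ} (hw : 0 < w) {M : ℕ} (hM : 0 < M) (x : ℝ) :
    ∃ j < M, ∃ n : ℤ, |x - (w * j + w * M * n)| ≤ w := by
  set m := ⌊x / w⌋
  have hM' : (0 : ℤ) < M := by exact_mod_cast hM
  have h0 := Int.emod_nonneg m hM'.ne'
  have h1 := Int.emod_lt_of_pos m hM'
  refine ⟨(m % M).toNat, by omega, m / M, ?_⟩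
  have e : ((m % M).toNat : ℝ) = ((m % M : ℤ) : ℝ) := by
    exact_mod_cast congrArg (Int.cast : ℤ → ℝ) (Int.toNat_of_nonneg h0)
  have e2 : w * ((m % M).toNat : ℝ) + w * M * ((m / M : ℤ) : ℝ) = w * m := by
    have : ((m % M + M * (m / M) : ℤ) : ℝ) = m := by rw [Int.emod_add_mul_ediv]
    push_cast at this
    rw [e, ← this]; ring
  rw [e2]
  have h2 := Int.floor_le (x / w)
  have h3 := Int.lt_floor_add_one (x / w)
  rw [le_div_iff₀ hw] at h2
  rw [div_lt_iff₀ hw] at h3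
  rw [abs_le]
  constructor <;> simp only [m] <;> linarith

lemma exists_resemblesOn_of_isCompact {μ : Measure ℝ} [IsProbabilityMeasure μ]
    {f : Set.Icc (-1 : ℝ) 1 → ℝ} (hf : LipschitzWith 1 f) (hf0 : f ⟨0, by norm_num⟩ = 0)
    {ε : ℝ} (hε : 0 < ε) {M : ℕ} (hM : 16 / ε < M) {g : ℝ → ℝ} (hg : LipschitzWith 1 g)
    {K : Set ℝ} (hK : IsCompact K) (hK0 : volume K = 0) {δ : ℝ} (hδ : 0 < δ) :
    ∃ h : ℝ → ℝ, LipschitzWith 1 h ∧ (∀ x, |h x - g x| ≤ δ) ∧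
      ∃ S ⊆ K, MeasurableSet S ∧ ResemblesOn f ε h S ∧ μ.real K ≤ M * μ.real S := by
  have hM0 : (0 : ℝ) < M := lt_trans (by positivity) hM
  have hMn : 0 < M := by exact_mod_cast hM0
  obtain ⟨U, hKU, hU, hUδ⟩ := K.exists_isOpen_le_add volume
    (ε := ENNReal.ofReal (δ / 2)) (by simpa using hδ)
  rw [hK0, zero_add] at hUδ
  obtain ⟨d, hd, hdU⟩ := hK.exists_cthickening_subset_open hU hKU
  set s := min d ε
  have hs : 0 < s := lt_min hd hε
  have hw : 0 < 4 * s / M := by positivity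
  set T : ℕ → Set ℝ := fun j =>
    K ∩ ⋃ n : ℤ, Metric.closedBall (4 * s / M * j + 4 * s / M * M * n) (4 * s / M)
  have hcov : K ⊆ ⋃ j ∈ Finset.range M, T j := fun x hx => by
    obtain ⟨j, hj, n, hn⟩ := exists_abs_sub_lattice_le hw hMn x
    simp only [Set.mem_iUnion, Finset.mem_range]
    exact ⟨j, hj, hx, Set.mem_iUnion.2 ⟨n, hn⟩⟩
  obtain ⟨j, -, hj⟩ : ∃ j ∈ Finset.range M, μ.real K / M ≤ μ.real (T j) := by
    refine Finset.exists_le_of_sum_le (by simpa using hMn.ne') ?_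
    rw [Finset.sum_const, Finset.card_range, nsmul_eq_mul, mul_div_cancel₀ _ hM0.ne']
    exact (measureReal_mono hcov (measure_ne_top _ _)).trans (measureReal_biUnion_finset_le _ _)
  obtain ⟨F, hF, hFf⟩ := exists_lipschitzWith_periodic hf (4 * s / M * j) hs
  obtain ⟨h, hh, hhg, hhF⟩ := exists_lipschitzWith_splice hF hg hU.measurableSet
    (half_pos hδ).le hUδ
  refine ⟨h, hh, fun x => (hhg x).trans (by linarith), T j, Set.inter_subset_left,
    hK.measurableSet.inter (MeasurableSet.iUnion fun n => measurableSet_closedBall),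
    ⟨s, hs, ε / 2, by linarith, fun x hx => ⟨s, le_rfl, min_le_right _ _, fun y => ?_⟩⟩, ?_⟩
  · obtain ⟨hxK, hx⟩ := hx
    obtain ⟨n, hn⟩ := Set.mem_iUnion.1 hx
    rw [div_mul_cancel₀ _ hM0.ne', Metric.mem_closedBall, Real.dist_eq] at hn
    have hsub : Set.uIcc x (x + s * y) ⊆ U := fun z hz => hdU <| by
      refine Metric.mem_cthickening_of_dist_le z x d K hxK ?_
      have h1 := Set.abs_sub_left_of_mem_uIcc hz
      have h2 : |(y : ℝ)| ≤ 1 := abs_le.2 y.2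
      rw [add_sub_cancel_left, abs_mul, abs_of_pos hs] at h1
      rw [Real.dist_eq]
      have h3 : s ≤ d := min_le_left _ _
      nlinarith
    rw [hhF _ _ hsub]
    set c := 4 * s / M * j + 4 * s * n
    have h1 := hF.dist_le_mul (x + s * y) (c + s * y)
    have h2 := hF.dist_le_mul x c
    have h3 : F (c + s * y) = s * f y := hFf n y
    have h4 : F c = 0 := by simpa [hf0] using hFf n ⟨0, by norm_num⟩
    rw [h3, NNReal.coe_one, one_mul, Real.dist_eq, Real.dist_eq, add_sub_add_right_eq_sub] at h1
    rw [h4, NNReal.coe_one, one_mul, Real.dist_eq, Real.dist_eq] at h2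
    have h5 : 4 * s / M ≤ ε / 4 * s := by
      rw [div_lt_iff₀ hε] at hM
      rw [div_le_iff₀ hM0]
      nlinarith
    have h6 := abs_le.1 (h1.trans (hn.trans h5))
    have h7 := abs_le.1 (h2.trans (hn.trans h5))
    rw [abs_le]
    constructor <;> linarith
  · rw [div_le_iff₀ hM0] at hj
    linarith

lemma ResemblesOn.exists_measure_compl_le {μ : Measure ℝ} [IsProbabilityMeasure μ]
    (hsing : μ ⟂ₘ (volume : Measure ℝ))
    {f : Set.Icc (-1 : ℝ) 1 → ℝ} (hf : LipschitzWith 1 f) (hf0 : f ⟨0, by norm_num⟩ = 0)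
    {ε : ℝ} (hε : 0 < ε) {M : ℕ} (hM : 16 / ε < M) {g : ℝ → ℝ} (hg : LipschitzWith 1 g)
    {S : Set ℝ} (hS : MeasurableSet S) (hgS : ResemblesOn f ε g S) {δ : ℝ} (hδ : 0 < δ) :
    ∃ h : ℝ → ℝ, LipschitzWith 1 h ∧ (∀ x, |h x - g x| ≤ δ) ∧
      ∃ T, MeasurableSet T ∧ ResemblesOn f ε h T ∧
        μ.real Tᶜ ≤ (1 - 1 / (2 * M)) * μ.real Sᶜ := by
  have hM0 : (0 : ℝ) < M := lt_trans (by positivity) hM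
  rcases eq_or_ne (μ Sᶜ) 0 with h0 | h0
  · exact ⟨g, hg, fun x => by simpa using hδ.le, S, hS, hgS, by simp [Measure.real, h0]⟩
  set B := Sᶜ ∩ hsing.nullSetᶜ
  have hB : μ B = μ Sᶜ := by
    refine le_antisymm (measure_mono Set.inter_subset_left) ?_
    refine (measure_le_inter_add_sdiff μ Sᶜ hsing.nullSetᶜ).trans ?_
    have : μ (Sᶜ \ hsing.nullSetᶜ) = 0 :=
      measure_mono_null (fun x hx => by simpa using hx.2) hsing.measure_nullSet
    rw [this, add_zero]
  have hB0 : volume B = 0 := measure_mono_null Set.inter_subset_right hsing.measure_compl_nullSet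
  obtain ⟨K, hKB, hK, hKμ⟩ := (hS.compl.inter hsing.measurableSet_nullSet.compl).exists_lt_isCompact
    (μ := μ) (r := μ B / 2) (ENNReal.half_lt_self (hB ▸ h0) (measure_ne_top _ _))
  have hKμ' : μ.real Sᶜ / 2 ≤ μ.real K := by
    have := ENNReal.toReal_mono (measure_ne_top _ _) hKμ.le
    rw [hB, ENNReal.toReal_div] at this
    simpa [Measure.real] using this
  obtain ⟨δ', hδ', hclose⟩ := hgS.exists_of_close
  obtain ⟨h, hh, hhg, T, hTK, hT, hhT, hTμ⟩ := exists_resemblesOn_of_isCompact (μ := μ) hf hf0 hε hM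
    hg hK (measure_mono_null hKB hB0) (lt_min hδ hδ')
  refine ⟨h, hh, fun x => (hhg x).trans (min_le_left _ _), S ∪ T, hS.union hT,
    (hclose h fun x => (hhg x).trans (min_le_right _ _)).union hhT, ?_⟩
  have hTS : T ⊆ Sᶜ := fun x hx => (hKB (hTK hx)).1
  have e : (S ∪ T)ᶜ = Sᶜ \ T := by rw [Set.compl_union, Set.sdiff_eq]
  rw [e, measureReal_sdiff hTS hT]
  have : 1 / (2 * M) * μ.real Sᶜ ≤ μ.real T := by
    rw [div_mul_eq_mul_div, div_le_iff₀ (by positivity)]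
    linarith
  linarith

lemma exists_resemblesOn_measure_compl_le {μ : Measure ℝ} [IsProbabilityMeasure μ]
    (hsing : μ ⟂ₘ (volume : Measure ℝ))
    {f : Set.Icc (-1 : ℝ) 1 → ℝ} (hf : LipschitzWith 1 f) (hf0 : f ⟨0, by norm_num⟩ = 0)
    {ε : ℝ} (hε : 0 < ε) {g : ℝ → ℝ} (hg : LipschitzWith 1 g) {δ : ℝ} (hδ : 0 < δ)
    {κ : ℝ} (hκ : 0 < κ) :
    ∃ h : ℝ → ℝ, LipschitzWith 1 h ∧ (∀ x, |h x - g x| ≤ δ) ∧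
      ∃ T, ResemblesOn f ε h T ∧ μ.real Tᶜ ≤ κ := by
  obtain ⟨M, hM⟩ := exists_nat_gt (16 / ε)
  have hM0 : (0 : ℝ) < M := lt_trans (by positivity) hM
  have hM1 : (1 : ℝ) ≤ M := by exact_mod_cast (show 0 < M by exact_mod_cast hM0)
  have hc0 : 0 ≤ 1 - 1 / (2 * (M : ℝ)) := by
    rw [sub_nonneg, div_le_one (by positivity)]
    linarith
  have hc1 : 1 - 1 / (2 * (M : ℝ)) < 1 := by
    rw [sub_lt_self_iff]
    positivity
  obtain ⟨N, hN⟩ := exists_pow_lt_of_lt_one hκ hc1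
  have key : ∀ n : ℕ, ∀ δ > 0, ∃ h : ℝ → ℝ, LipschitzWith 1 h ∧ (∀ x, |h x - g x| ≤ δ) ∧
      ∃ T, MeasurableSet T ∧ ResemblesOn f ε h T ∧ μ.real Tᶜ ≤ (1 - 1 / (2 * (M : ℝ))) ^ n := by
    intro n
    induction n with
    | zero =>
      exact fun δ hδ => ⟨g, hg, fun x => by simpa using hδ.le, ∅, .empty,
        ⟨1, one_pos, 0, hε, by simp⟩, by simp⟩
    | succ n ih =>
      intro δ hδ
      obtain ⟨h, hh, hhg, T, hT, hhT, hTμ⟩ := ih (δ / 2) (half_pos hδ)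
      obtain ⟨h', hh', hhg', T', hT', hhT', hTμ'⟩ :=
        hhT.exists_measure_compl_le hsing hf hf0 hε hM hh hT (half_pos hδ)
      refine ⟨h', hh', fun x => ?_, T', hT', hhT', hTμ'.trans ?_⟩
      · linarith [abs_sub_le (h' x) (h x) (g x), hhg x, hhg' x]
      · rw [pow_succ']
        exact mul_le_mul_of_nonneg_left hTμ hc0
  obtain ⟨h, hh, hhg, T, -, hhT, hTμ⟩ := key N δ hδ
  exact ⟨h, hh, hhg, T, hhT, hTμ.trans hN.le⟩

/-- If `μ` is a singular probability measure on `ℝ` and `f` is `1`-Lipschitz with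
`f 0 = 0`, then `X_f = {g : f ∈ Tan(g,x) for μ-a.e. x}` is residual in `X`: it contains
a countable intersection of sets that are open and dense for the supremum distance. -/
theorem stmt_10 (μ : Measure ℝ) [IsProbabilityMeasure μ]
    (hsing : μ ⟂ₘ (volume : Measure ℝ))
    (f : (Set.Icc (-1 : ℝ) 1) → ℝ) (hf : LipschitzWith 1 f)
    (hf0 : f ⟨0, by norm_num⟩ = 0) :
    ∃ D : ℕ → Set XLip,
      (∀ k, ∀ g ∈ D k, ∃ δ : ℝ, 0 < δ ∧
        ∀ h : XLip, (∀ x, |h.1 x - g.1 x| < δ) → h ∈ D k) ∧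
      (∀ k (g : XLip), ∀ δ : ℝ, 0 < δ → ∃ h ∈ D k, ∀ x, |h.1 x - g.1 x| ≤ δ) ∧
      (∀ g ∈ ⋂ k, D k, ∀ᵐ x ∂μ, f ∈ Tan1 (g : XLip).1 x) := by
  refine ⟨fun k => {g | ∃ S, ResemblesOn f (1 / ((k : ℝ) + 1)) g.1 S ∧ μ.real Sᶜ ≤ (1 / 2) ^ k},
    ?_, ?_, ?_⟩
  · rintro k g ⟨S, hgS, hS⟩
    obtain ⟨δ, hδ, H⟩ := hgS.exists_of_close
    exact ⟨δ, hδ, fun h hh => ⟨S, H h.1 fun x => (hh x).le, hS⟩⟩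
  · intro k g δ hδ
    obtain ⟨h, hh, hhg, T, hhT, hT⟩ := exists_resemblesOn_measure_compl_le hsing hf hf0
      (ε := 1 / ((k : ℝ) + 1)) (by positivity) g.2 hδ (κ := (1 / 2) ^ k) (by positivity)
    exact ⟨⟨h, hh⟩, ⟨T, hhT, hT⟩, hhg⟩
  · intro g hg
    choose S hgS hS using fun k => Set.mem_iInter.1 hg k
    have hsum : ∑' k, μ (S k)ᶜ ≠ ⊤ := by
      refine ne_top_of_le_ne_top (b := ∑' k : ℕ, ENNReal.ofReal ((1 / 2) ^ k))
        summable_geometric_two.tsum_ofReal_ne_top (ENNReal.tsum_le_tsum fun k => ?_)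
      rw [← ofReal_measureReal]
      exact ENNReal.ofReal_le_ofReal (hS k)
    filter_upwards [ae_eventually_notMem hsum] with x hx
    exact mem_Tan1_of_resembles hgS (hx.mono fun k hk => by simpa using hk)
end

section
/- Let μ be a singular Radon measure on an open set Ω ⊆ ℝ. Then for the generic 1-Lipschitz function g : Ω → ℝ (in the sense of Baire category in the space of 1-Lipschitz functions on Ω with the sup metric), at μ-almost every point x ∈ Ω the set of blowups Tan(g,x) equals the set of all 1-Lipschitz functions on [−1,1] vanishing at 0. In particular, any Borel map f assigning to μ-a.e. x a 1-Lipschitz function vanishing at 0 prescribes the blowups of a Lipschitz function weakly with respect to μ. -/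
open MeasureTheory Filter

/-- Replace the derivative of a `1`-Lipschitz function by `p` on a set `V`. -/
theorem exists_lipschitz_splice {g p : ℝ → ℝ} (hg : LipschitzWith 1 g) (hp : Measurable p)
    (hp1 : ∀ t, |p t| ≤ 1) {V : Set ℝ} (hV : MeasurableSet V) (hVf : volume V ≠ ⊤) :
    ∃ h : ℝ → ℝ, LipschitzWith 1 h ∧ (∀ x, |h x - g x| ≤ 2 * volume.real V) ∧
      ∀ a b, Set.uIcc a b ⊆ V → h b - h a = ∫ t in a..b, p t := by
  classical
  set q : ℝ → ℝ := V.piecewise p (deriv g) with hq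
  have hdg : ∀ t, |deriv g t| ≤ 1 := fun t => by
    simpa using norm_deriv_le_of_lipschitz (x₀ := t) hg
  have hq1 : ∀ t, |q t| ≤ 1 := fun t => by
    by_cases ht : t ∈ V <;> simp [hq, ht, hp1, hdg]
  have hqm : Measurable q := hp.piecewise hV (measurable_deriv g)
  have hint : ∀ {u : ℝ → ℝ}, Measurable u → (∀ t, |u t| ≤ 1) → ∀ a b,
      IntervalIntegrable u volume a b := fun {u} hu hu1 a b =>
    (intervalIntegrable_const (c := (1 : ℝ))).mono_fun hu.aestronglyMeasurable
      (Eventually.of_forall fun t => by simpa using hu1 t)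
  have hsub : ∀ a b, (g 0 + ∫ t in (0 : ℝ)..b, q t) - (g 0 + ∫ t in (0 : ℝ)..a, q t)
      = ∫ t in a..b, q t := fun a b => by
    rw [← intervalIntegral.integral_interval_sub_left (hint hqm hq1 0 b) (hint hqm hq1 0 a)]
    ring
  refine ⟨fun x => g 0 + ∫ t in (0 : ℝ)..x, q t, ?_, ?_, ?_⟩
  · refine LipschitzWith.of_dist_le_mul fun x y => ?_
    rw [Real.dist_eq, hsub]
    have := intervalIntegral.norm_integral_le_of_norm_le_const (a := y) (b := x) (f := q)
      (C := 1) fun t _ => hq1 t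
    simpa [Real.dist_eq] using this
  · intro x
    have hgx : g x = g 0 + ∫ t in (0 : ℝ)..x, deriv g t := by
      rw [(hg.lipschitzOnWith).absolutelyContinuousOnInterval.integral_deriv_eq_sub]
      ring
    have e : (g 0 + ∫ t in (0 : ℝ)..x, q t) - g x = ∫ t in (0 : ℝ)..x, (q t - deriv g t) := by
      rw [intervalIntegral.integral_sub (hint hqm hq1 _ _)
        (hint (measurable_deriv g) hdg _ _), hgx]
      ring
    change |(g 0 + ∫ t in (0 : ℝ)..x, q t) - g x| ≤ _
    rw [e, ← Real.norm_eq_abs]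
    refine intervalIntegral.norm_integral_le_integral_norm_uIoc.trans ?_
    have hI : Integrable (V.indicator fun _ : ℝ => (2 : ℝ)) :=
      (integrable_indicator_iff hV).2 (integrableOn_const hVf)
    calc ∫ t in Set.uIoc 0 x, ‖q t - deriv g t‖
        ≤ ∫ t in Set.uIoc 0 x, V.indicator (fun _ : ℝ => (2 : ℝ)) t := by
          refine integral_mono_of_nonneg (Eventually.of_forall fun t => norm_nonneg _)
            hI.integrableOn (Eventually.of_forall fun t => ?_)
          by_cases ht : t ∈ V
          · simp only [hq, ht, Set.piecewise_eq_of_mem, Set.indicator_of_mem, Real.norm_eq_abs]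
            exact (abs_sub _ _).trans (by linarith [hp1 t, hdg t])
          · simp [hq, ht]
      _ ≤ ∫ t, V.indicator (fun _ : ℝ => (2 : ℝ)) t :=
          setIntegral_le_integral hI (Eventually.of_forall fun t =>
            Set.indicator_nonneg (fun _ _ => zero_le_two) t)
      _ = 2 * volume.real V := by
          rw [integral_indicator hV, setIntegral_const, smul_eq_mul, mul_comm]
  · intro a b hab
    change (g 0 + ∫ t in (0 : ℝ)..b, q t) - (g 0 + ∫ t in (0 : ℝ)..a, q t) = _
    rw [hsub]
    exact intervalIntegral.integral_congr fun t ht => by simp [hq, hab ht]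

/-- The derivative of `2r`-periodically repeated copies of `f|_[-1,1]`, rescaled to width `2r`
and centred at `a + 2rℤ`. -/
noncomputable def periodicDeriv (f : ℝ → ℝ) (r a t : ℝ) : ℝ :=
  deriv f (2 * Int.fract ((t - a) / (2 * r) + 1 / 2) - 1)

theorem measurable_periodicDeriv (f : ℝ → ℝ) (r a : ℝ) : Measurable (periodicDeriv f r a) :=
  (measurable_deriv f).comp (by fun_prop)

theorem abs_periodicDeriv_le {f : ℝ → ℝ} (hf : LipschitzWith 1 f) (r a t : ℝ) :
    |periodicDeriv f r a t| ≤ 1 := by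
  simpa only [NNReal.coe_one] using! norm_deriv_le_of_lipschitz (x₀ := 2 * Int.fract ((t - a) / (2 * r) + 1 / 2) - 1) hf

theorem integral_periodicDeriv {f : ℝ → ℝ} (hf : LipschitzWith 1 f) {r : ℝ} (hr : 0 < r) (a : ℝ)
    (z : ℤ) {s t : ℝ} (hs : |s| < 1) (ht : |t| < 1) :
    ∫ τ in (a + 2 * r * z + r * s)..(a + 2 * r * z + r * t), periodicDeriv f r a τ
      = r * (f t - f s) := by
  rw [abs_lt] at hs ht
  have e : ∫ τ in (a + 2 * r * z + r * s)..(a + 2 * r * z + r * t), periodicDeriv f r a τ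
      = ∫ τ in (a + 2 * r * z + r * s)..(a + 2 * r * z + r * t),
          deriv f (τ / r - (a + 2 * r * z) / r) := by
    refine intervalIntegral.integral_congr fun τ hτ => ?_
    have h1 : -1 < (τ - (a + 2 * r * z)) / r := by
      rw [lt_div_iff₀ hr]
      rcases Set.mem_uIcc.1 hτ with h | h <;> nlinarith
    have h2 : (τ - (a + 2 * r * z)) / r < 1 := by
      rw [div_lt_iff₀ hr]
      rcases Set.mem_uIcc.1 hτ with h | h <;> nlinarith
    have h3 : (τ - a) / (2 * r) + 1 / 2 = ((τ - (a + 2 * r * z)) / r + 1) / 2 + (z : ℝ) := by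
      field_simp
      ring
    have h4 : Int.fract ((τ - a) / (2 * r) + 1 / 2) = ((τ - (a + 2 * r * z)) / r + 1) / 2 := by
      rw [h3, Int.fract_add_intCast, Int.fract_eq_self]
      constructor <;> linarith
    simp only [periodicDeriv]
    rw [h4]
    congr 1
    ring
  rw [e, intervalIntegral.integral_comp_div_sub _ hr.ne',
    (hf.lipschitzOnWith).absolutelyContinuousOnInterval.integral_deriv_eq_sub, smul_eq_mul]
  congr 3 <;> (field_simp; ring)

/-- At every point of `X` the function `g` has a blowup, at a scale below `ε`, closer to `f`
than `ε`, with uniform bounds. -/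
def BlowupNear (Ω : Set ℝ) (f : ℝ → ℝ) (ε : ℝ) (g : ℝ → ℝ) (X : Set ℝ) : Prop :=
  ∃ c < ε, ∃ r₀ > 0, ∀ x ∈ X, ∃ r, r₀ ≤ r ∧ r < ε ∧ ∀ y ∈ Set.Icc (-1 : ℝ) 1,
    x + r * y ∈ Ω ∧ |g (x + r * y) - g x - r * f y| ≤ c * r

theorem BlowupNear.stable {Ω : Set ℝ} {f : ℝ → ℝ} {ε : ℝ} {g : ℝ → ℝ} {X : Set ℝ}
    (H : BlowupNear Ω f ε g X) :
    ∃ δ > 0, ∀ h : ℝ → ℝ, (∀ x ∈ Ω, |h x - g x| ≤ δ) → BlowupNear Ω f ε h X := by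
  obtain ⟨c, hc, r₀, hr₀, H⟩ := H
  refine ⟨r₀ * (ε - c) / 4, by have := sub_pos.2 hc; positivity, fun h hh =>
    ⟨(c + ε) / 2, by linarith, r₀, hr₀, fun x hx => ?_⟩⟩
  obtain ⟨r, h1, h2, h3⟩ := H x hx
  refine ⟨r, h1, h2, fun y hy => ⟨(h3 y hy).1, ?_⟩⟩
  have hxΩ : x ∈ Ω := by simpa using (h3 0 (by norm_num)).1
  have b1 := abs_le.1 (hh x hxΩ)
  have b2 := abs_le.1 (hh _ (h3 y hy).1)
  have b3 := abs_le.1 (h3 y hy).2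
  have : r₀ * (ε - c) ≤ r * (ε - c) := mul_le_mul_of_nonneg_right h1 (sub_pos.2 hc).le
  rw [abs_le]
  constructor <;> linarith [b1.1, b1.2, b2.1, b2.2, b3.1, b3.2]

theorem BlowupNear.union {Ω : Set ℝ} {f : ℝ → ℝ} {ε : ℝ} {g : ℝ → ℝ} {X Y : Set ℝ}
    (hX : BlowupNear Ω f ε g X) (hY : BlowupNear Ω f ε g Y) : BlowupNear Ω f ε g (X ∪ Y) := by
  obtain ⟨c, hc, r₀, hr₀, hX⟩ := hX
  obtain ⟨d, hd, s₀, hs₀, hY⟩ := hY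
  refine ⟨max c d, max_lt hc hd, min r₀ s₀, lt_min hr₀ hs₀, ?_⟩
  rintro x (hx | hx)
  · obtain ⟨r, h1, h2, h3⟩ := hX x hx
    exact ⟨r, (min_le_left _ _).trans h1, h2, fun y hy => ⟨(h3 y hy).1, (h3 y hy).2.trans
      (mul_le_mul_of_nonneg_right (le_max_left _ _) (hr₀.le.trans h1))⟩⟩
  · obtain ⟨r, h1, h2, h3⟩ := hY x hx
    exact ⟨r, (min_le_right _ _).trans h1, h2, fun y hy => ⟨(h3 y hy).1, (h3 y hy).2.trans
      (mul_le_mul_of_nonneg_right (le_max_right _ _) (hs₀.le.trans h1))⟩⟩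

/-- The points at distance at most `κ * r` from the progression `a + 2rℤ`. -/
def nearProgression (κ r a : ℝ) : Set ℝ :=
  ⋃ z : ℤ, Metric.closedBall (a + 2 * r * z) (κ * r)

theorem measurableSet_nearProgression (κ r a : ℝ) : MeasurableSet (nearProgression κ r a) :=
  MeasurableSet.iUnion fun _ => Metric.isClosed_closedBall.measurableSet

theorem exists_mem_nearProgression {M : ℕ} (hM : 0 < M) {r : ℝ} (hr : 0 < r) (x : ℝ) :
    ∃ j ∈ Finset.range M, x ∈ nearProgression (2 / M) r (2 * r * j / M) := by
  have hM' : (0 : ℝ) < M := by exact_mod_cast hM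
  set w := Int.fract (x / (2 * r)) with hw
  have hw0 : 0 ≤ w := Int.fract_nonneg _
  have hw1 : w < 1 := Int.fract_lt_one _
  have h0 : 0 ≤ M * w := by positivity
  refine ⟨⌊M * w⌋₊, ?_, ?_⟩
  · rw [Finset.mem_range, Nat.floor_lt h0]
    nlinarith
  · refine Set.mem_iUnion.2 ⟨⌊x / (2 * r)⌋, ?_⟩
    have hx : x = 2 * r * (⌊x / (2 * r)⌋ + w) := by
      rw [hw, Int.floor_add_fract]
      field_simp
    have f1 := Nat.floor_le h0
    have f2 := Nat.lt_floor_add_one (M * w)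
    have e : x - (2 * r * ⌊M * w⌋₊ / M + 2 * r * ⌊x / (2 * r)⌋)
        = 2 * r / M * (M * w - ⌊M * w⌋₊) := by
      conv_lhs => lhs; rw [hx]
      field_simp
      ring
    have hc : 0 < 2 * r / M := by positivity
    rw [Metric.mem_closedBall, Real.dist_eq, e, abs_of_nonneg (mul_nonneg hc.le (by linarith)),
      div_mul_eq_mul_div 2 (M : ℝ) r]
    nlinarith

theorem exists_measure_nearProgression (μ : Measure ℝ) {S : Set ℝ} (hS : μ S ≠ ⊤) {M : ℕ}
    (hM : 0 < M) {r : ℝ} (hr : 0 < r) :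
    ∃ a, μ.real S ≤ M * μ.real (S ∩ nearProgression (2 / M) r a) := by
  by_contra! hlt
  have hM' : (0 : ℝ) < M := by exact_mod_cast hM
  have hcov : S ⊆ ⋃ j ∈ Finset.range M, S ∩ nearProgression (2 / M) r (2 * r * j / M) := by
    intro x hx
    obtain ⟨j, hj, hxj⟩ := exists_mem_nearProgression hM hr x
    exact Set.mem_biUnion hj ⟨hx, hxj⟩
  have h1 : μ.real S
      ≤ ∑ j ∈ Finset.range M, μ.real (S ∩ nearProgression (2 / M) r (2 * r * j / M)) :=
    (measureReal_mono hcov (measure_ne_top_of_subset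
      (Set.iUnion₂_subset fun _ _ => Set.inter_subset_left) hS)).trans
      (measureReal_biUnion_finset_le _ _)
  have h2 : ∑ j ∈ Finset.range M, μ.real (S ∩ nearProgression (2 / M) r (2 * r * j / M))
      < ∑ j ∈ Finset.range M, μ.real S / M :=
    Finset.sum_lt_sum_of_nonempty (Finset.nonempty_range_iff.2 hM.ne') fun j _ => by
      rw [lt_div_iff₀ hM', mul_comm]
      exact hlt _
  rw [Finset.sum_const, Finset.card_range, nsmul_eq_mul, mul_div_cancel₀ _ hM'.ne'] at h2
  linarith

/-- Perturb `g` near the null compact set `K` so that it looks like `f` near a definite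
proportion of the points of `S ⊆ K`. -/
theorem exists_perturbation_proportion (μ : Measure ℝ) {Ω K : Set ℝ} (hΩ : IsOpen Ω)
    (hK : IsCompact K) (hKΩ : K ⊆ Ω) (hK0 : volume K = 0)
    {f : ℝ → ℝ} (hf : LipschitzWith 1 f) (hf0 : f 0 = 0) {ε : ℝ} (hε : 0 < ε) {M : ℕ}
    (hM : 0 < M) (hM4 : 2 / (M : ℝ) ≤ 1 / 4) (hMε : 2 / (M : ℝ) ≤ ε / 24)
    {S : Set ℝ} (hSK : S ⊆ K) (hS : μ S ≠ ⊤) {g : ℝ → ℝ} (hg : LipschitzWith 1 g)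
    {δ : ℝ} (hδ : 0 < δ) :
    ∃ h : ℝ → ℝ, LipschitzWith 1 h ∧ (∀ x, |h x - g x| ≤ δ) ∧
      ∃ T, MeasurableSet T ∧ μ.real S ≤ M * μ.real (S ∩ T) ∧ BlowupNear Ω f ε h (S ∩ T) := by
  obtain ⟨ρ, hρ, hρΩ⟩ := hK.exists_cthickening_subset_open hΩ hKΩ
  have hsmall : ∀ᶠ r in nhdsWithin (0 : ℝ) (Set.Ioi 0),
      volume (Metric.cthickening (2 * r) K) < ENNReal.ofReal (δ / 2) := by
    have h1 : Tendsto (fun r : ℝ => 2 * r) (nhdsWithin 0 (Set.Ioi 0)) (nhds 0) := by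
      have : Tendsto (fun r : ℝ => 2 * r) (nhds 0) (nhds (2 * 0)) :=
        (continuous_const.mul continuous_id).tendsto 0
      rw [mul_zero] at this
      exact this.mono_left nhdsWithin_le_nhds
    have h2 := (tendsto_measure_cthickening_of_isCompact (μ := volume) hK).comp h1
    rw [hK0] at h2
    exact h2.eventually_lt_const (by simpa using hδ)
  have hlt : ∀ᶠ r in nhdsWithin (0 : ℝ) (Set.Ioi 0), r < min ε ρ :=
    nhdsWithin_le_nhds (Iio_mem_nhds (lt_min hε hρ))
  obtain ⟨r, hV, hrlt, hr⟩ := (hsmall.and (hlt.and self_mem_nhdsWithin)).exists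
  replace hr : 0 < r := hr
  obtain ⟨a, ha⟩ := exists_measure_nearProgression μ hS hM hr
  obtain ⟨h, hh, hhg, hhp⟩ := exists_lipschitz_splice hg (measurable_periodicDeriv f r a)
    (abs_periodicDeriv_le hf r a) Metric.isClosed_cthickening.measurableSet hV.ne_top
  refine ⟨h, hh, fun x => (hhg x).trans ?_, _, measurableSet_nearProgression (2 / M) r a, ha, ?_⟩
  · have := ENNReal.toReal_le_of_le_ofReal (by positivity) hV.le
    rw [Measure.real]
    linarith
  set κ : ℝ := 2 / M with hκ
  have hκ0 : 0 < κ := by positivity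
  have hε2 : 0 < (1 - 2 * κ) * r := mul_pos (by linarith) hr
  refine ⟨ε / 2, by linarith, (1 - 2 * κ) * r, hε2, ?_⟩
  rintro x ⟨hxS, hxA⟩
  have hrε : (1 - 2 * κ) * r ≤ r := by nlinarith
  refine ⟨_, le_rfl, hrε.trans_lt (hrlt.trans_le (min_le_left _ _)), fun y hy => ?_⟩
  have hy1 : |y| ≤ 1 := abs_le.2 hy
  obtain ⟨z, hz⟩ := Set.mem_iUnion.1 hxA
  rw [Metric.mem_closedBall, Real.dist_eq] at hz
  obtain ⟨t, hxt⟩ : ∃ t, x = a + 2 * r * z + r * t :=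
    ⟨(x - (a + 2 * r * z)) / r, by field_simp; ring⟩
  have ht : |t| ≤ κ := by
    rw [hxt, add_sub_cancel_left, abs_mul, abs_of_pos hr, mul_comm] at hz
    exact le_of_mul_le_mul_right hz hr
  have hκy : |(1 - 2 * κ) * y| ≤ 1 - 2 * κ := by
    rw [abs_mul, abs_of_pos (by linarith : (0 : ℝ) < 1 - 2 * κ)]
    exact mul_le_of_le_one_right (by linarith) hy1
  have hty : |t + (1 - 2 * κ) * y| < 1 := (abs_add_le _ _).trans_lt (by linarith)
  have hxy : x + (1 - 2 * κ) * r * y = a + 2 * r * z + r * (t + (1 - 2 * κ) * y) := by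
    rw [hxt]; ring
  refine ⟨hρΩ (Metric.mem_cthickening_of_dist_le _ x ρ K (hSK hxS) ?_), ?_⟩
  · rw [Real.dist_eq, add_sub_cancel_left, mul_right_comm, abs_mul, abs_of_pos hr]
    have := min_le_right ε ρ
    nlinarith
  · have hsub : Set.uIcc x (x + (1 - 2 * κ) * r * y) ⊆ Metric.cthickening (2 * r) K := by
      intro τ hτ
      refine Metric.mem_cthickening_of_dist_le _ x _ K (hSK hxS) ?_
      have h1 := Set.abs_sub_left_of_mem_uIcc hτ
      rw [add_sub_cancel_left, mul_right_comm, abs_mul, abs_of_pos hr] at h1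
      rw [Real.dist_eq]
      nlinarith
    have key := hhp _ _ hsub
    rw [hxy, hxt, integral_periodicDeriv hf hr a z (ht.trans_lt (by linarith)) hty] at key
    rw [hxy, hxt, key]
    have l1 : |f (t + (1 - 2 * κ) * y) - f y| ≤ 3 * κ := by
      have := hf.dist_le_mul (t + (1 - 2 * κ) * y) y
      rw [Real.dist_eq, Real.dist_eq, NNReal.coe_one, one_mul,
        show t + (1 - 2 * κ) * y - y = t - 2 * κ * y by ring] at this
      refine this.trans ((abs_sub _ _).trans ?_)
      rw [abs_mul, abs_of_pos (by linarith : (0 : ℝ) < 2 * κ)]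
      nlinarith
    have l0 : ∀ s, |f s| ≤ |s| := fun s => by
      simpa [Real.dist_eq, hf0] using hf.dist_le_mul s 0
    have l2 : |f t| ≤ κ := (l0 t).trans ht
    have l3 : |2 * κ * f y| ≤ 2 * κ := by
      rw [abs_mul, abs_of_pos (by linarith : (0 : ℝ) < 2 * κ)]
      exact mul_le_of_le_one_right (by linarith) ((l0 y).trans hy1)
    have e : r * (f (t + (1 - 2 * κ) * y) - f t) - (1 - 2 * κ) * r * f y
        = r * ((f (t + (1 - 2 * κ) * y) - f y) - f t + 2 * κ * f y) := by ring
    rw [e, abs_mul, abs_of_pos hr]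
    have l4 : |(f (t + (1 - 2 * κ) * y) - f y) - f t + 2 * κ * f y| ≤ 6 * κ :=
      (abs_add_le _ _).trans (by linarith [abs_sub (f (t + (1 - 2 * κ) * y) - f y) (f t)])
    have l5 : 6 * κ ≤ ε / 2 * (1 - 2 * κ) := by nlinarith
    nlinarith

theorem exists_blowupNear_of_measure_ne_top (μ : Measure ℝ) {Ω K : Set ℝ} (hΩ : IsOpen Ω)
    (hK : IsCompact K) (hKΩ : K ⊆ Ω) (hK0 : volume K = 0) (hKμ : μ K ≠ ⊤)
    {f : ℝ → ℝ} (hf : LipschitzWith 1 f) (hf0 : f 0 = 0) {ε : ℝ} (hε : 0 < ε)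
    {g : ℝ → ℝ} (hg : LipschitzWith 1 g) {δ : ℝ} (hδ : 0 < δ) :
    ∃ h : ℝ → ℝ, LipschitzWith 1 h ∧ (∀ x, |h x - g x| ≤ δ) ∧
      ∃ X, μ (K \ X) ≤ ENNReal.ofReal ε ∧ BlowupNear Ω f ε h X := by
  obtain ⟨M, hMb⟩ := exists_nat_gt (max 8 (48 / ε))
  have hM8 : (8 : ℝ) < M := (le_max_left _ _).trans_lt hMb
  have hMp : (0 : ℝ) < M := by linarith
  have hM4 : 2 / (M : ℝ) ≤ 1 / 4 := by
    rw [div_le_div_iff₀ hMp (by norm_num)]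
    linarith
  have hMε : 2 / (M : ℝ) ≤ ε / 24 := by
    have := (div_lt_iff₀ hε).1 ((le_max_right _ _).trans_lt hMb)
    rw [div_le_div_iff₀ hMp (by norm_num)]
    linarith
  have hM : 0 < M := by exact_mod_cast hMp
  have hθ0 : 0 ≤ 1 - 1 / (M : ℝ) := by
    rw [sub_nonneg, div_le_one hMp]
    linarith
  have hθ1 : 1 - 1 / (M : ℝ) < 1 := by
    have : 0 < 1 / (M : ℝ) := by positivity
    linarith
  have main : ∀ n : ℕ, ∀ δ : ℝ, 0 < δ → ∃ h : ℝ → ℝ, LipschitzWith 1 h ∧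
      (∀ x, |h x - g x| ≤ δ) ∧ ∃ X, μ.real (K \ X) ≤ (1 - 1 / (M : ℝ)) ^ n * μ.real K ∧
        BlowupNear Ω f ε h X := by
    intro n
    induction n with
    | zero =>
      exact fun δ hδ => ⟨g, hg, fun x => by simpa using hδ.le, ∅, by simp,
        ε / 2, by linarith, 1, one_pos, fun x hx => absurd hx (Set.notMem_empty x)⟩
    | succ n ih =>
      intro δ hδ
      obtain ⟨h, hh, hhg, X, hX, hB⟩ := ih (δ / 2) (by positivity)
      obtain ⟨δ₀, hδ₀, hst⟩ := hB.stable
      have hS : μ (K \ X) ≠ ⊤ := measure_ne_top_of_subset Set.sdiff_subset hKμ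
      obtain ⟨h', hh', hhh', T, hT, hTS, hB'⟩ := exists_perturbation_proportion μ hΩ hK hKΩ hK0
        hf hf0 hε hM hM4 hMε Set.sdiff_subset hS hh (lt_min (half_pos hδ) hδ₀)
      refine ⟨h', hh', fun x => ?_, X ∪ (K \ X) ∩ T, ?_,
        (hst h' fun x _ => (hhh' x).trans (min_le_right _ _)).union hB'⟩
      · have := (hhh' x).trans (min_le_left _ _)
        exact (abs_sub_le _ (h x) _).trans (by linarith [hhg x])
      · have e : K \ (X ∪ (K \ X) ∩ T) = (K \ X) \ T := by
          ext x
          simp only [Set.mem_sdiff, Set.mem_union, Set.mem_inter_iff]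
          tauto
        have h1 := measureReal_inter_add_sdiff (μ := μ) (s := K \ X) hT hS
        have h2 : μ.real (K \ X) / M ≤ μ.real ((K \ X) ∩ T) := by
          rwa [div_le_iff₀' hMp]
        calc μ.real (K \ (X ∪ (K \ X) ∩ T))
            ≤ (1 - 1 / (M : ℝ)) * μ.real (K \ X) := by
              rw [e, sub_mul, one_mul, one_div_mul_eq_div]
              linarith
          _ ≤ (1 - 1 / (M : ℝ)) ^ (n + 1) * μ.real K := by
              rw [pow_succ', mul_assoc]
              exact mul_le_mul_of_nonneg_left hX hθ0
  have hlim : Tendsto (fun n : ℕ => (1 - 1 / (M : ℝ)) ^ n * μ.real K) atTop (nhds 0) := by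
    simpa using (tendsto_pow_atTop_nhds_zero_of_lt_one hθ0 hθ1).mul_const (μ.real K)
  obtain ⟨n, hn⟩ := (hlim.eventually_lt_const hε).exists
  obtain ⟨h, hh, hhg, X, hX, hB⟩ := main n δ hδ
  refine ⟨h, hh, hhg, X, ?_, hB⟩
  rw [ENNReal.le_ofReal_iff_toReal_le (measure_ne_top_of_subset Set.sdiff_subset hKμ) hε.le]
  exact hX.trans hn.le

theorem exists_seq_compact_of_mutuallySingular (μ : Measure ℝ) [IsLocallyFiniteMeasure μ]
    (hsing : μ ⟂ₘ (volume : Measure ℝ)) {Ω : Set ℝ} (hΩ : MeasurableSet Ω) :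
    ∃ K : ℕ → Set ℝ, (∀ p, IsCompact (K p) ∧ K p ⊆ Ω ∧ volume (K p) = 0) ∧
      μ (Ω \ ⋃ p, K p) = 0 := by
  obtain ⟨N, hN, hμN, hvN⟩ := hsing
  have hA : ∀ p : ℕ, MeasurableSet ((Ω ∩ Nᶜ) ∩ Metric.closedBall 0 (p : ℝ)) := fun p =>
    (hΩ.inter hN.compl).inter Metric.isClosed_closedBall.measurableSet
  have hAf : ∀ p : ℕ, μ ((Ω ∩ Nᶜ) ∩ Metric.closedBall 0 (p : ℝ)) ≠ ⊤ := fun p =>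
    measure_ne_top_of_subset Set.inter_subset_right
      (isCompact_closedBall (0 : ℝ) (p : ℝ)).measure_lt_top.ne
  choose C hCA hC hCμ using fun (p q : ℕ) => (hA p).exists_isCompact_sdiff_lt (hAf p)
    (ε := ENNReal.ofReal (1 / ((q : ℝ) + 1))) (by
      have : (0 : ℝ) < 1 / ((q : ℝ) + 1) := by positivity
      simpa using this)
  refine ⟨fun k => C k.unpair.1 k.unpair.2, fun k => ⟨hC _ _,
    fun x hx => (hCA _ _ hx).1.1, measure_mono_null (fun x hx => (hCA _ _ hx).1.2) hvN⟩, ?_⟩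
  have hsub : Ω \ ⋃ k : ℕ, C k.unpair.1 k.unpair.2 ⊆
      N ∪ ⋃ p : ℕ, ⋂ q : ℕ, ((Ω ∩ Nᶜ) ∩ Metric.closedBall 0 (p : ℝ)) \ C p q := by
    rintro x ⟨hx, hxC⟩
    by_cases hxN : x ∈ N
    · exact Or.inl hxN
    · obtain ⟨p, hp⟩ := exists_nat_ge (dist x 0)
      refine Or.inr (Set.mem_iUnion.2 ⟨p, Set.mem_iInter.2 fun q => ⟨⟨⟨hx, hxN⟩, hp⟩, fun h => ?_⟩⟩)
      exact hxC (Set.mem_iUnion.2 ⟨Nat.pair p q, by simpa using h⟩)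
  refine measure_mono_null hsub (measure_union_null hμN (measure_iUnion_null fun p => ?_))
  refine le_antisymm (ge_of_tendsto' (x := atTop)
    (f := fun q : ℕ => ENNReal.ofReal (1 / ((q : ℝ) + 1))) ?_
    fun q => (measure_mono (Set.iInter_subset _ q)).trans (hCμ p q).le) zero_le
  simpa using ENNReal.tendsto_ofReal (tendsto_one_div_add_atTop_nhds_zero_nat (𝕜 := ℝ))

theorem exists_dense_seq_lipschitz :
    ∃ f : ℕ → ℝ → ℝ, (∀ m, LipschitzWith 1 (f m) ∧ f m 0 = 0) ∧
      ∀ F : Set.Icc (-1 : ℝ) 1 → ℝ, LipschitzWith 1 F → F ⟨0, by norm_num⟩ = 0 →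
        ∀ ε > 0, ∃ m, ∀ y : Set.Icc (-1 : ℝ) 1, |F y - f m y| < ε := by
  let L : Set C(Set.Icc (-1 : ℝ) 1, ℝ) := {F | LipschitzWith 1 F ∧ F ⟨0, by norm_num⟩ = 0}
  have : Nonempty L := ⟨⟨0, (LipschitzWith.const (0 : ℝ)).weaken zero_le, rfl⟩⟩
  let u : ℕ → L := TopologicalSpace.denseSeq L
  have h11 : (-1 : ℝ) ≤ 1 := by norm_num
  refine ⟨fun m => Set.IccExtend h11 (u m).1, fun m => ⟨?_, ?_⟩, fun F hF hF0 ε hε => ?_⟩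
  · simpa only [one_mul] using! (u m).2.1.comp (LipschitzWith.projIcc h11)
  · beta_reduce
    rw [Set.IccExtend_of_mem h11 _ (show (0 : ℝ) ∈ Set.Icc (-1 : ℝ) 1 by norm_num)]
    exact (u m).2.2
  · obtain ⟨m, hm⟩ := (TopologicalSpace.denseRange_denseSeq L).exists_dist_lt
      (⟨⟨F, hF.continuous⟩, hF, hF0⟩ : L) hε
    refine ⟨m, fun y => ?_⟩
    beta_reduce
    rw [Set.IccExtend_val, ← Real.dist_eq]
    exact (ContinuousMap.dist_apply_le_dist (f := ⟨F, hF.continuous⟩) (g := (u m).1) y).trans_lt hm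

theorem Tan1_subset_of_lipschitzOnWith {Ω : Set ℝ} (hΩ : IsOpen Ω) {g : ℝ → ℝ}
    (hg : LipschitzOnWith 1 g Ω) {x : ℝ} (hx : x ∈ Ω) :
    Tan1 g x ⊆ {f | LipschitzWith 1 f ∧ f ⟨0, by norm_num⟩ = 0} := by
  rintro f ⟨r, hr, hr0, hf⟩
  have hmem : ∀ y : Set.Icc (-1 : ℝ) 1, ∀ᶠ j in atTop, x + r j * (y : ℝ) ∈ Ω := fun y => by
    have h1 : Tendsto (fun j => x + r j * (y : ℝ)) atTop (nhds x) := by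
      simpa using (hr0.mul_const (y : ℝ)).const_add x
    exact h1.eventually (hΩ.mem_nhds hx)
  refine ⟨LipschitzWith.of_dist_le_mul fun y z => ?_, ?_⟩
  · have hlim := (hf.tendsto_at y).dist (hf.tendsto_at z)
    refine le_of_tendsto hlim ?_
    filter_upwards [hmem y, hmem z] with j hy hz
    have h1 := hg.dist_le_mul _ hy _ hz
    rw [Real.dist_eq, Real.dist_eq, add_sub_add_left_eq_sub, ← mul_sub, abs_mul,
      abs_of_pos (hr j)] at h1
    rw [Real.dist_eq, ← sub_div, abs_div, abs_of_pos (hr j), div_le_iff₀ (hr j),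
      sub_sub_sub_cancel_right, Subtype.dist_eq, Real.dist_eq]
    linarith
  · refine tendsto_nhds_unique (hf.tendsto_at _) ?_
    simp

theorem subset_Tan1_of_forall_exists {f : ℕ → ℝ → ℝ}
    (hfd : ∀ F : Set.Icc (-1 : ℝ) 1 → ℝ, LipschitzWith 1 F → F ⟨0, by norm_num⟩ = 0 →
        ∀ ε > 0, ∃ m, ∀ y : Set.Icc (-1 : ℝ) 1, |F y - f m y| < ε)
    {g : ℝ → ℝ} {x : ℝ}
    (H : ∀ m n : ℕ, ∃ r, 0 < r ∧ r < 1 / ((n : ℝ) + 1) ∧ ∀ y ∈ Set.Icc (-1 : ℝ) 1,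
      |g (x + r * y) - g x - r * f m y| ≤ 1 / ((n : ℝ) + 1) * r) :
    {F | LipschitzWith 1 F ∧ F ⟨0, by norm_num⟩ = 0} ⊆ Tan1 g x := by
  rintro F ⟨hF, hF0⟩
  choose m hm using fun n : ℕ => hfd F hF hF0 (1 / ((n : ℝ) + 1)) (by positivity)
  choose r hr hrn hrg using fun n : ℕ => H (m n) n
  have hlim := tendsto_one_div_add_atTop_nhds_zero_nat (𝕜 := ℝ)
  refine ⟨r, hr, squeeze_zero (fun n => (hr n).le) (fun n => (hrn n).le) hlim, ?_⟩
  rw [Metric.tendstoUniformly_iff]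
  intro ε hε
  filter_upwards [hlim.eventually_lt_const (half_pos hε)] with n hn y
  have h1 : |(g (x + r n * y) - g x) / r n - f (m n) y| ≤ 1 / ((n : ℝ) + 1) := by
    have e : (g (x + r n * y) - g x) / r n - f (m n) y
        = (g (x + r n * y) - g x - r n * f (m n) y) / r n := by
      have := (hr n).ne'
      field_simp
    rw [e, abs_div, abs_of_pos (hr n), div_le_iff₀ (hr n)]
    exact hrg n y y.2
  rw [abs_sub_comm] at h1
  rw [Real.dist_eq]
  exact (abs_sub_le _ (f (m n) y) _).trans_lt (by linarith [hm n y])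

/-- The functions that have blowups close to `f` at all points of `K` outside a set of
small `μ`-measure. -/
def mostlyBlowupNear (μ : Measure ℝ) (Ω K : Set ℝ) (f : ℝ → ℝ) (n : ℕ) : Set (ℝ → ℝ) :=
  {g | ∃ X, μ (K \ X) ≤ ENNReal.ofReal (1 / ((n : ℝ) + 1)) ∧
    BlowupNear Ω f (1 / ((n : ℝ) + 1)) g X}

theorem ae_exists_of_forall_mem_mostlyBlowupNear {μ : Measure ℝ} {Ω K : Set ℝ} {f : ℝ → ℝ}
    {g : ℝ → ℝ} (hg : ∀ n, g ∈ mostlyBlowupNear μ Ω K f n) (n : ℕ) :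
    μ {x ∈ K | ¬ ∃ r, 0 < r ∧ r < 1 / ((n : ℝ) + 1) ∧ ∀ y ∈ Set.Icc (-1 : ℝ) 1,
      |g (x + r * y) - g x - r * f y| ≤ 1 / ((n : ℝ) + 1) * r} = 0 := by
  refine le_antisymm (ge_of_tendsto (x := atTop)
    (f := fun q : ℕ => ENNReal.ofReal (1 / ((q : ℝ) + 1))) ?_ ?_) zero_le
  · simpa using ENNReal.tendsto_ofReal (tendsto_one_div_add_atTop_nhds_zero_nat (𝕜 := ℝ))
  filter_upwards [eventually_ge_atTop n] with q hq
  obtain ⟨X, hX, c, hc, r₀, hr₀, H⟩ := hg q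
  refine (measure_mono ?_).trans hX
  rintro x ⟨hxK, hx⟩
  refine ⟨hxK, fun hxX => hx ?_⟩
  obtain ⟨r, h1, h2, h3⟩ := H x hxX
  have hqn : 1 / ((q : ℝ) + 1) ≤ 1 / ((n : ℝ) + 1) := by
    have : (n : ℝ) ≤ q := by exact_mod_cast hq
    gcongr
  have hr : 0 < r := hr₀.trans_le h1
  exact ⟨r, hr, h2.trans_le hqn, fun y hy => (h3 y hy).2.trans
    (mul_le_mul_of_nonneg_right (hc.le.trans hqn) hr.le)⟩

open scoped BoundedContinuousFunction in
/-- A Baire category argument in the complete space of bounded `1`-Lipschitz functions. -/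
theorem exists_lipschitz_mem_iInter {E : ℕ → Set (ℝ → ℝ)}
    (hopen : ∀ k, ∀ g ∈ E k, ∃ δ > 0, ∀ h : ℝ → ℝ, (∀ x, |h x - g x| ≤ δ) → h ∈ E k)
    (hdense : ∀ k (g : ℝ → ℝ), LipschitzWith 1 g → ∀ δ > 0,
      ∃ h ∈ E k, LipschitzWith 1 h ∧ ∀ x, |h x - g x| ≤ δ) :
    ∃ g : ℝ → ℝ, LipschitzWith 1 g ∧ ∀ k, g ∈ E k := by
  let L : Set (ℝ →ᵇ ℝ) := {u | LipschitzWith 1 u}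
  have hL : IsClosed L := by
    have : L = ⋂ x : ℝ, ⋂ y : ℝ, {u : ℝ →ᵇ ℝ | dist (u x) (u y) ≤ 1 * dist x y} := by
      ext u
      simp [L, lipschitzWith_iff_dist_le_mul]
    rw [this]
    exact isClosed_iInter fun x => isClosed_iInter fun y => isClosed_le
      ((continuous_eval_const x).dist
        (continuous_eval_const y)) continuous_const
  have : CompleteSpace L := hL.completeSpace_coe
  have : Nonempty L := ⟨⟨0, (LipschitzWith.const (0 : ℝ)).weaken zero_le⟩⟩
  have ho : ∀ k, IsOpen {u : L | (u.1 : ℝ → ℝ) ∈ E k} := fun k => by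
    refine Metric.isOpen_iff.2 fun u hu => ?_
    obtain ⟨δ, hδ, H⟩ := hopen k _ hu
    refine ⟨δ, hδ, fun v hv => H _ fun x => ?_⟩
    rw [← Real.dist_eq]
    exact (BoundedContinuousFunction.dist_coe_le_dist x).trans (Metric.mem_ball.1 hv).le
  have hd : ∀ k, Dense {u : L | (u.1 : ℝ → ℝ) ∈ E k} := fun k => by
    refine Metric.dense_iff.2 fun u δ hδ => ?_
    obtain ⟨h, hE, hh, hhu⟩ := hdense k u.1 u.2 (δ / 2) (half_pos hδ)
    let v : ℝ →ᵇ ℝ := BoundedContinuousFunction.ofNormedAddCommGroup h hh.continuous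
      (δ / 2 + ‖u.1‖) fun x => by
        have h1 := u.1.norm_coe_le_norm x
        have h2 := norm_add_le (h x - u.1 x) (u.1 x)
        rw [sub_add_cancel] at h2
        have h3 : ‖h x - u.1 x‖ ≤ δ / 2 := hhu x
        linarith
    refine ⟨⟨v, hh⟩, Metric.mem_ball.2 (lt_of_le_of_lt ?_ (half_lt_self hδ)), hE⟩
    exact (BoundedContinuousFunction.dist_le (half_pos hδ).le).2 fun x => hhu x
  obtain ⟨u, hu⟩ := (dense_iInter_of_isOpen_nat ho hd).nonempty
  exact ⟨u.1, u.2, fun k => Set.mem_iInter.1 hu k⟩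

/-- For a singular Radon measure `μ` on an open set `Ω ⊆ ℝ`, the generic `1`-Lipschitz
function `g` on `Ω` (residually many, for the sup distance on `Ω`) satisfies: at
`μ`-a.e. `x ∈ Ω`, `Tan(g,x)` is the set of all `1`-Lipschitz functions on `[-1,1]`
vanishing at `0`. In particular every Borel assignment of admissible blowups is
prescribed weakly by some Lipschitz function. -/
theorem stmt_11 (μ : Measure ℝ) [IsLocallyFiniteMeasure μ]
    (hsing : μ ⟂ₘ (volume : Measure ℝ))
    (Ω : Set ℝ) (hΩ : IsOpen Ω) :
    (∃ D : ℕ → Set {g : ℝ → ℝ // LipschitzOnWith 1 g Ω},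
      (∀ k, ∀ g ∈ D k, ∃ δ : ℝ, 0 < δ ∧
        ∀ h : {g : ℝ → ℝ // LipschitzOnWith 1 g Ω},
          (∀ x ∈ Ω, |h.1 x - g.1 x| < δ) → h ∈ D k) ∧
      (∀ k (g : {g : ℝ → ℝ // LipschitzOnWith 1 g Ω}), ∀ δ : ℝ, 0 < δ →
        ∃ h ∈ D k, ∀ x ∈ Ω, |h.1 x - g.1 x| ≤ δ) ∧
      (∀ g ∈ ⋂ k, D k, ∀ᵐ x ∂(μ.restrict Ω),
        Tan1 (g : {g : ℝ → ℝ // LipschitzOnWith 1 g Ω}).1 x =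
          {f : (Set.Icc (-1 : ℝ) 1) → ℝ |
            LipschitzWith 1 f ∧ f ⟨0, by norm_num⟩ = 0})) ∧
    (∀ F : ℝ → ((Set.Icc (-1 : ℝ) 1) → ℝ),
      (∀ᵐ x ∂(μ.restrict Ω), LipschitzWith 1 (F x) ∧ F x ⟨0, by norm_num⟩ = 0) →
      ∃ g : ℝ → ℝ, (∃ K : NNReal, LipschitzOnWith K g Ω) ∧
        ∀ᵐ x ∂(μ.restrict Ω), F x ∈ Tan1 g x) := by
  obtain ⟨K, hK, hKμ⟩ := exists_seq_compact_of_mutuallySingular μ hsing hΩ.measurableSet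
  obtain ⟨f, hf, hfd⟩ := exists_dense_seq_lipschitz
  obtain ⟨e, he⟩ := exists_surjective_nat (ℕ × ℕ × ℕ)
  let E : ℕ → Set (ℝ → ℝ) := fun k => mostlyBlowupNear μ Ω (K (e k).1) (f (e k).2.1) (e k).2.2
  have hopen : ∀ k, ∀ g ∈ E k, ∃ δ > 0, ∀ h : ℝ → ℝ, (∀ x ∈ Ω, |h x - g x| ≤ δ) → h ∈ E k := by
    rintro k g ⟨X, hX, hB⟩
    obtain ⟨δ, hδ, H⟩ := hB.stable
    exact ⟨δ, hδ, fun h hh => ⟨X, hX, H h hh⟩⟩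
  have hdense : ∀ k (g : ℝ → ℝ), LipschitzWith 1 g → ∀ δ > 0,
      ∃ h ∈ E k, LipschitzWith 1 h ∧ ∀ x, |h x - g x| ≤ δ := by
    intro k g hg δ hδ
    obtain ⟨hKc, hKΩ, hK0⟩ := hK (e k).1
    obtain ⟨h, hh, hhg, X, hX, hB⟩ := exists_blowupNear_of_measure_ne_top μ hΩ hKc hKΩ hK0
      hKc.measure_lt_top.ne (hf (e k).2.1).1 (hf (e k).2.1).2
      (ε := 1 / (((e k).2.2 : ℝ) + 1)) (by positivity) hg hδ
    exact ⟨h, ⟨X, hX, hB⟩, hh, hhg⟩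
  have htan : ∀ g : ℝ → ℝ, LipschitzOnWith 1 g Ω → (∀ k, g ∈ E k) → ∀ᵐ x ∂(μ.restrict Ω),
      Tan1 g x = {f : (Set.Icc (-1 : ℝ) 1) → ℝ |
        LipschitzWith 1 f ∧ f ⟨0, by norm_num⟩ = 0} := by
    intro g hg hgE
    have hall : ∀ p m n : ℕ, ∀ᵐ x ∂μ, x ∈ K p → ∃ r, 0 < r ∧ r < 1 / ((n : ℝ) + 1) ∧
        ∀ y ∈ Set.Icc (-1 : ℝ) 1,
          |g (x + r * y) - g x - r * f m y| ≤ 1 / ((n : ℝ) + 1) * r := by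
      intro p m n
      rw [ae_iff]
      simp only [Classical.not_imp]
      refine ae_exists_of_forall_mem_mostlyBlowupNear (Ω := Ω) (fun q => ?_) n
      obtain ⟨k, hk⟩ := he (p, m, q)
      simpa [E, hk] using hgE k
    have hcov : ∀ᵐ x ∂μ, x ∈ Ω → x ∈ ⋃ p, K p := by
      rw [ae_iff]
      simpa only [Classical.not_imp] using! hKμ
    rw [ae_restrict_iff' hΩ.measurableSet]
    filter_upwards [hcov, ae_all_iff.2 fun p => ae_all_iff.2 fun m => ae_all_iff.2 (hall p m)]
      with x hx hgood hxΩ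
    obtain ⟨p, hp⟩ := Set.mem_iUnion.1 (hx hxΩ)
    exact (Tan1_subset_of_lipschitzOnWith hΩ hg hxΩ).antisymm
      (subset_Tan1_of_forall_exists hfd fun m n => hgood p m n hp)
  refine ⟨⟨fun k => {g | g.1 ∈ E k}, fun k g hg => ?_, fun k g δ hδ => ?_, fun g hg => ?_⟩,
    fun F hF => ?_⟩
  · obtain ⟨δ, hδ, H⟩ := hopen k g.1 hg
    exact ⟨δ, hδ, fun h hh => H h.1 fun x hx => (hh x hx).le⟩
  · obtain ⟨g', hg', heq⟩ := g.2.extend_real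
    obtain ⟨h, hE, hh, hhg⟩ := hdense k g' hg' δ hδ
    refine ⟨⟨h, hh.lipschitzOnWith⟩, hE, fun x hx => ?_⟩
    rw [heq hx]
    exact hhg x
  · exact htan g.1 g.2 fun k => Set.mem_iInter.1 hg k
  · obtain ⟨g, hg, hgE⟩ := exists_lipschitz_mem_iInter (fun k g hg => by
      obtain ⟨δ, hδ, H⟩ := hopen k g hg
      exact ⟨δ, hδ, fun h hh => H h fun x _ => hh x⟩) hdense
    refine ⟨g, ⟨1, hg.lipschitzOnWith⟩, ?_⟩
    filter_upwards [hF, htan g hg.lipschitzOnWith hgE] with x hFx hx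
    rw [hx]
    exact hFx
end
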